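/- The weighted contact bracket is K(2)-invariant as a map F_λ ⊗ F_μ → F_{λ+μ+1}: for all λ, μ ∈ ℂ and all homogeneous f, g, h ∈ A, defining {f,g}_{λ,μ} = μ f′g − λ fg′ − (−1)^{p(f)}(1/2)(D̄₁(f)D̄₁(g) + D̄₂(f)D̄₂(g)), one has L^{λ+μ+1}_{X_h}({f,g}_{λ,μ}) = {L^λ_{X_h}(f), g}_{λ,μ} + (−1)^{p(h)p(f)} {f, L^μ_{X_h}(g)}_{λ,μ}. -/

import Mathlib

/-!
Functions on the supercircle `S^{1|2}`: the superalgebra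
`A = C^∞(ℝ,ℂ)[ξ₁,ξ₂]`.  An element `f = f₀ + ξ₁f₁ + ξ₂f₂ + ξ₁ξ₂f₁₂`
is encoded by the 4-tuple `(f₀, f₁, f₂, f₁₂)` of functions `ℝ → ℂ`.
-/

noncomputable section

abbrev SA : Type := (ℝ → ℂ) × (ℝ → ℂ) × (ℝ → ℂ) × (ℝ → ℂ)

namespace SA

def a0 (f : SA) : ℝ → ℂ := f.1
def a1 (f : SA) : ℝ → ℂ := f.2.1
def a2 (f : SA) : ℝ → ℂ := f.2.2.1
def a12 (f : SA) : ℝ → ℂ := f.2.2.2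

/-- all four component functions are smooth -/
def Smooth (f : SA) : Prop :=
  ContDiff ℝ (⊤ : ℕ∞) (a0 f) ∧ ContDiff ℝ (⊤ : ℕ∞) (a1 f) ∧ ContDiff ℝ (⊤ : ℕ∞) (a2 f) ∧ ContDiff ℝ (⊤ : ℕ∞) (a12 f)

/-- the (super-commutative) product of the Grassmann algebra `A`;
`ξᵢ² = 0`, `ξ₁ξ₂ = -ξ₂ξ₁`. -/
def gmul (f g : SA) : SA :=
  (a0 f * a0 g,
   a0 f * a1 g + a1 f * a0 g,
   a0 f * a2 g + a2 f * a0 g,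
   a0 f * a12 g + a12 f * a0 g + a1 f * a2 g - a2 f * a1 g)

scoped infixl:70 " ⊙ " => SA.gmul

/-- the unit `1 ∈ A` -/
def one : SA := (1, 0, 0, 0)
/-- the even coordinate `x ∈ A` -/
def xx : SA := (fun t => (t : ℂ), 0, 0, 0)
/-- the odd coordinate `ξ₁ ∈ A` -/
def xi1 : SA := (0, 1, 0, 0)
/-- the odd coordinate `ξ₂ ∈ A` -/
def xi2 : SA := (0, 0, 1, 0)

/-- `∂_x`, differentiating the coefficients -/
def dx (f : SA) : SA := (deriv (a0 f), deriv (a1 f), deriv (a2 f), deriv (a12 f))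
/-- the left Grassmann derivative `∂_{ξ₁}` -/
def dxi1 (f : SA) : SA := (a1 f, 0, a12 f, 0)
/-- the left Grassmann derivative `∂_{ξ₂}` -/
def dxi2 (f : SA) : SA := (a2 f, -a12 f, 0, 0)
/-- `D̄₁ = ∂_{ξ₁} - ξ₁∂_x` -/
def D1 (f : SA) : SA := dxi1 f - xi1 ⊙ dx f
/-- `D̄₂ = ∂_{ξ₂} - ξ₂∂_x` -/
def D2 (f : SA) : SA := dxi2 f - xi2 ⊙ dx f

def IsEven (f : SA) : Prop := a1 f = 0 ∧ a2 f = 0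
def IsOdd (f : SA) : Prop := a0 f = 0 ∧ a12 f = 0
/-- `f` is homogeneous of parity `b` (`false` = even, `true` = odd) -/
def Homog (b : Bool) (f : SA) : Prop := if b then IsOdd f else IsEven f
/-- `(-1)^b` -/
def sgn (b : Bool) : ℂ := if b then -1 else 1
/-- `(-1)^(b*c)` -/
def sgn2 (b c : Bool) : ℂ := if b && c then -1 else 1

/-- the contact vector field `X_f` (with `f` homogeneous of parity `b`)
applied to `g`:  `X_f(g) = f ∂_x g - (-1)^{p(f)} ½ (D̄₁(f)D̄₁(g) + D̄₂(f)D̄₂(g))` -/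
def XV (b : Bool) (f : SA) (g : SA) : SA :=
  f ⊙ dx g - (sgn b * (2 : ℂ)⁻¹) • (D1 f ⊙ D1 g + D2 f ⊙ D2 g)

/-- the Lie derivative `L^λ_{X_f} = X_f + λ f'` on `λ`-densities -/
def Lden (b : Bool) (f : SA) (lam : ℂ) (g : SA) : SA :=
  XV b f g + lam • (dx f ⊙ g)

/-- the contact bracket `{f,g} = fg' - f'g - (-1)^{p(f)} ½ (D̄₁(f)D̄₁(g) + D̄₂(f)D̄₂(g))` -/
def cbr (b : Bool) (f g : SA) : SA :=
  f ⊙ dx g - dx f ⊙ g - (sgn b * (2 : ℂ)⁻¹) • (D1 f ⊙ D1 g + D2 f ⊙ D2 g)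

/-- the Lie derivative `𝓛_{X_f}(T) = L^μ_{X_f}∘T - (-1)^{p(f)p(T)} T∘L^λ_{X_f}`
of a homogeneous operator `T` of parity `bT` from `λ`- to `μ`-densities -/
def LieD (bf : Bool) (f : SA) (lam mu : ℂ) (bT : Bool) (T : SA → SA) : SA → SA :=
  fun g => Lden bf f mu (T g) - sgn2 bf bT • T (Lden bf f lam g)

def applyIf (b : Bool) (F : SA → SA) (g : SA) : SA := if b then F g else g

/-- the monomial operator `∂_x^ℓ D̄₁^m D̄₂^n` -/
def monoD (l : ℕ) (m n : Bool) (g : SA) : SA := dx^[l] (applyIf m D1 (applyIf n D2 g))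

def bnat (b : Bool) : ℕ := if b then 1 else 0

/-- membership in `D^{K/2}_{λμ}`: differential operators
`Σ a_{ℓ,m,n} ∂_x^ℓ D̄₁^m D̄₂^n` of contact order `ℓ + m/2 + n/2 ≤ K/2`. -/
def InD (K : ℕ) (T : SA → SA) : Prop :=
  ∃ a : ℕ → Bool → Bool → SA,
    (∀ l m n, Smooth (a l m n)) ∧
    (∀ l m n, ¬ (2 * l + bnat m + bnat n ≤ K) → a l m n = 0) ∧
    (∀ g, Smooth g →
      T g = ∑ l ∈ Finset.range (K + 1), ∑ m : Bool, ∑ n : Bool, a l m n ⊙ monoD l m n g)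

end SA

namespace SA

/-- the weighted contact bracket
`{f,g}_{λ,μ} = μ f'g - λ fg' - (-1)^{p(f)} ½ (D̄₁(f)D̄₁(g) + D̄₂(f)D̄₂(g))` -/
noncomputable def wbr (lam mu : ℂ) (b : Bool) (f g : SA) : SA :=
  mu • (dx f ⊙ g) - lam • (f ⊙ dx g)
    - (sgn b * (2 : ℂ)⁻¹) • (D1 f ⊙ D1 g + D2 f ⊙ D2 g)

end SA

open SA

namespace SA

/-- the parity involution of `A` -/
def par (f : SA) : SA := (a0 f, -a1 f, -a2 f, a12 f)

section Smooth

variable {f g : SA}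

lemma Smooth.add (hf : Smooth f) (hg : Smooth g) : Smooth (f + g) :=
  ⟨hf.1.add hg.1, hf.2.1.add hg.2.1, hf.2.2.1.add hg.2.2.1, hf.2.2.2.add hg.2.2.2⟩

lemma Smooth.sub (hf : Smooth f) (hg : Smooth g) : Smooth (f - g) :=
  ⟨hf.1.sub hg.1, hf.2.1.sub hg.2.1, hf.2.2.1.sub hg.2.2.1, hf.2.2.2.sub hg.2.2.2⟩

lemma Smooth.smul (c : ℂ) (hf : Smooth f) : Smooth (c • f) :=
  ⟨hf.1.const_smul c, hf.2.1.const_smul c, hf.2.2.1.const_smul c, hf.2.2.2.const_smul c⟩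

lemma Smooth.gmul (hf : Smooth f) (hg : Smooth g) : Smooth (f ⊙ g) := by
  obtain ⟨f0, f1, f2, f12⟩ := hf
  obtain ⟨g0, g1, g2, g12⟩ := hg
  exact ⟨f0.mul g0, (f0.mul g1).add (f1.mul g0), (f0.mul g2).add (f2.mul g0),
    (((f0.mul g12).add (f12.mul g0)).add (f1.mul g2)).sub (f2.mul g1)⟩

lemma contDiff_deriv {u : ℝ → ℂ} (hu : ContDiff ℝ (⊤ : ℕ∞) u) :
    ContDiff ℝ (⊤ : ℕ∞) (deriv u) :=
  (contDiff_infty_iff_deriv.1 hu).2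

lemma Smooth.dx (hf : Smooth f) : Smooth (dx f) :=
  ⟨contDiff_deriv hf.1, contDiff_deriv hf.2.1, contDiff_deriv hf.2.2.1, contDiff_deriv hf.2.2.2⟩

lemma smooth_xi1 : Smooth xi1 :=
  ⟨contDiff_const, contDiff_const, contDiff_const, contDiff_const⟩

lemma smooth_xi2 : Smooth xi2 :=
  ⟨contDiff_const, contDiff_const, contDiff_const, contDiff_const⟩

lemma Smooth.D1 (hf : Smooth f) : Smooth (D1 f) :=
  Smooth.sub ⟨hf.2.1, contDiff_const, hf.2.2.2, contDiff_const⟩ (smooth_xi1.gmul hf.dx)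

lemma Smooth.D2 (hf : Smooth f) : Smooth (D2 f) :=
  Smooth.sub ⟨hf.2.2.1, hf.2.2.2.neg, contDiff_const, contDiff_const⟩ (smooth_xi2.gmul hf.dx)

end Smooth

lemma D1_eq (f : SA) : D1 f = (a1 f, -deriv (a0 f), a12 f, -deriv (a2 f)) := by
  simp [D1, dxi1, xi1, gmul, dx, a0, a1, a2, a12]

lemma D2_eq (f : SA) : D2 f = (a2 f, -a12 f, -deriv (a0 f), deriv (a1 f)) := by
  simp [D2, dxi2, xi2, gmul, dx, a0, a1, a2, a12]

section Leibniz

variable {f g : SA}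

lemma Smooth.differentiable (hf : Smooth f) :
    Differentiable ℝ (a0 f) ∧ Differentiable ℝ (a1 f) ∧
      Differentiable ℝ (a2 f) ∧ Differentiable ℝ (a12 f) :=
  ⟨hf.1.differentiable (by simp), hf.2.1.differentiable (by simp),
    hf.2.2.1.differentiable (by simp), hf.2.2.2.differentiable (by simp)⟩

lemma deriv_add_fun {u v : ℝ → ℂ} (hu : Differentiable ℝ u) (hv : Differentiable ℝ v) :
    deriv (u + v) = deriv u + deriv v :=
  funext fun t => deriv_add (hu t) (hv t)

lemma deriv_sub_fun {u v : ℝ → ℂ} (hu : Differentiable ℝ u) (hv : Differentiable ℝ v) :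
    deriv (u - v) = deriv u - deriv v :=
  funext fun t => deriv_sub (hu t) (hv t)

lemma deriv_mul_fun {u v : ℝ → ℂ} (hu : Differentiable ℝ u) (hv : Differentiable ℝ v) :
    deriv (u * v) = deriv u * v + u * deriv v :=
  funext fun t => deriv_mul (hu t) (hv t)

lemma deriv_smul_fun {u : ℝ → ℂ} (c : ℂ) (hu : Differentiable ℝ u) :
    deriv (c • u) = c • deriv u :=
  funext fun t => deriv_const_smul c (hu t)

lemma dx_add (hf : Smooth f) (hg : Smooth g) : dx (f + g) = dx f + dx g := by
  obtain ⟨f0, f1, f2, f12⟩ := hf.differentiable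
  obtain ⟨g0, g1, g2, g12⟩ := hg.differentiable
  exact Prod.ext (deriv_add_fun f0 g0) (Prod.ext (deriv_add_fun f1 g1)
    (Prod.ext (deriv_add_fun f2 g2) (deriv_add_fun f12 g12)))

lemma dx_smul (c : ℂ) (hf : Smooth f) : dx (c • f) = c • dx f := by
  obtain ⟨f0, f1, f2, f12⟩ := hf.differentiable
  exact Prod.ext (deriv_smul_fun c f0) (Prod.ext (deriv_smul_fun c f1)
    (Prod.ext (deriv_smul_fun c f2) (deriv_smul_fun c f12)))

lemma dx_sub (hf : Smooth f) (hg : Smooth g) : dx (f - g) = dx f - dx g := by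
  obtain ⟨f0, f1, f2, f12⟩ := hf.differentiable
  obtain ⟨g0, g1, g2, g12⟩ := hg.differentiable
  exact Prod.ext (deriv_sub_fun f0 g0) (Prod.ext (deriv_sub_fun f1 g1)
    (Prod.ext (deriv_sub_fun f2 g2) (deriv_sub_fun f12 g12)))

lemma dx_gmul (hf : Smooth f) (hg : Smooth g) : dx (f ⊙ g) = dx f ⊙ g + f ⊙ dx g := by
  obtain ⟨f0, f1, f2, f12⟩ := hf.differentiable
  obtain ⟨g0, g1, g2, g12⟩ := hg.differentiable
  refine Prod.ext ?_ (Prod.ext ?_ (Prod.ext ?_ ?_))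
  · exact deriv_mul_fun f0 g0
  · change deriv (a0 f * a1 g + a1 f * a0 g) = _
    rw [deriv_add_fun (f0.mul g1) (f1.mul g0), deriv_mul_fun f0 g1, deriv_mul_fun f1 g0]
    simp only [gmul, dx, a0, a1, Prod.snd_add, Prod.fst_add]
    ring
  · change deriv (a0 f * a2 g + a2 f * a0 g) = _
    rw [deriv_add_fun (f0.mul g2) (f2.mul g0), deriv_mul_fun f0 g2, deriv_mul_fun f2 g0]
    simp only [gmul, dx, a0, a2, Prod.snd_add, Prod.fst_add]
    ring
  · change deriv (a0 f * a12 g + a12 f * a0 g + a1 f * a2 g - a2 f * a1 g) = _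
    rw [deriv_sub_fun (((f0.mul g12).add (f12.mul g0)).add (f1.mul g2)) (f2.mul g1),
      deriv_add_fun ((f0.mul g12).add (f12.mul g0)) (f1.mul g2),
      deriv_add_fun (f0.mul g12) (f12.mul g0), deriv_mul_fun f0 g12, deriv_mul_fun f12 g0,
      deriv_mul_fun f1 g2, deriv_mul_fun f2 g1]
    simp only [gmul, dx, a0, a1, a2, a12, Prod.snd_add]
    ring

lemma D1_add (hf : Smooth f) (hg : Smooth g) : D1 (f + g) = D1 f + D1 g := by
  simp only [D1, dx_add hf hg]
  ext <;> simp [dxi1, xi1, gmul, a0, a1, a2, a12] <;> ring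

lemma D2_add (hf : Smooth f) (hg : Smooth g) : D2 (f + g) = D2 f + D2 g := by
  simp only [D2, dx_add hf hg]
  ext <;> simp [dxi2, xi2, gmul, a0, a1, a2, a12] <;> ring

lemma D1_sub (hf : Smooth f) (hg : Smooth g) : D1 (f - g) = D1 f - D1 g := by
  simp only [D1, dx_sub hf hg]
  ext <;> simp [dxi1, xi1, gmul, a0, a1, a2, a12] <;> ring

lemma D2_sub (hf : Smooth f) (hg : Smooth g) : D2 (f - g) = D2 f - D2 g := by
  simp only [D2, dx_sub hf hg]
  ext <;> simp [dxi2, xi2, gmul, a0, a1, a2, a12] <;> ring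

lemma D1_smul (c : ℂ) (hf : Smooth f) : D1 (c • f) = c • D1 f := by
  simp only [D1, dx_smul c hf]
  ext <;> simp [dxi1, xi1, gmul, a0, a1, a2, a12]

lemma D2_smul (c : ℂ) (hf : Smooth f) : D2 (c • f) = c • D2 f := by
  simp only [D2, dx_smul c hf]
  ext <;> simp [dxi2, xi2, gmul, a0, a1, a2, a12]

lemma D1_gmul (hf : Smooth f) (hg : Smooth g) : D1 (f ⊙ g) = D1 f ⊙ g + par f ⊙ D1 g := by
  simp only [D1, dx_gmul hf hg]
  ext <;> simp [par, dxi1, xi1, gmul, dx, a0, a1, a2, a12] <;> ring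

lemma D2_gmul (hf : Smooth f) (hg : Smooth g) : D2 (f ⊙ g) = D2 f ⊙ g + par f ⊙ D2 g := by
  simp only [D2, dx_gmul hf hg]
  ext <;> simp [par, dxi2, xi2, gmul, dx, a0, a1, a2, a12] <;> ring

end Leibniz

end SA

set_option maxHeartbeats 4000000 in
/-- The weighted contact bracket is `K(2)`-invariant as a map
`F_λ ⊗ F_μ → F_{λ+μ+1}`. -/
theorem statement3 :
    ∀ (lam mu : ℂ) (bh bf bg : Bool) (h f g : SA),
      Smooth h → Smooth f → Smooth g → Homog bh h → Homog bf f → Homog bg g →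
      Lden bh h (lam + mu + 1) (wbr lam mu bf f g)
        = wbr lam mu (xor bh bf) (Lden bh h lam f) g
          + sgn2 bh bf • wbr lam mu bf f (Lden bh h mu g) := by
  intro lam mu bh bf bg h f g sh sf sg ph pf _
  simp only [Lden, XV, wbr]
  simp (maxDischargeDepth := 12) only [dx_add, dx_sub, dx_smul, dx_gmul, D1_add, D1_sub, D1_smul, D1_gmul,
    D2_add, D2_sub, D2_smul, D2_gmul, sh, sf, sg, Smooth.add, Smooth.sub, Smooth.smul,
    Smooth.gmul, Smooth.dx, Smooth.D1, Smooth.D2]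
  obtain ⟨h0, h1, h2, h12⟩ := h
  obtain ⟨f0, f1, f2, f12⟩ := f
  cases bh <;> cases bf <;> obtain ⟨rfl, rfl⟩ := ph <;> obtain ⟨rfl, rfl⟩ := pf <;>
    simp only [D1_eq, D2_eq, par, gmul, dx, a0, a1, a2, a12, deriv_zero, deriv.neg', neg_zero,
      zero_mul, mul_zero, add_zero, zero_add, sub_zero, zero_sub, neg_neg, smul_zero, Prod.mk_add_mk,
      Prod.mk_sub_mk, Prod.smul_mk, Prod.mk.injEq] <;>
    refine ⟨?_, ?_, ?_, ?_⟩ <;> ext t <;>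
    simp [sgn, sgn2] <;> ring
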